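/- Let ∗ and ∗̃ be natural differential star products on (U, π₀) with C₁ = C̃₁. Define the bidifferential operator {f,g}₁ := (C₂(f,g) − C₂(g,f)) − (C̃₂(f,g) − C̃₂(g,f)). Then {·,·}₁ is skew-symmetric and a derivation in each argument (hence is given by a bivector field π₁ on U), and π₁ is a Poisson 2-cocycle with respect to π₀, i.e. for all f, g, h ∈ C^∞(U): {{f,g}₀,h}₁ + {{g,h}₀,f}₁ + {{h,f}₀,g}₁ + {{f,g}₁,h}₀ + {{g,h}₁,f}₀ + {{h,f}₁,g}₀ = 0. -/

import Mathlib

noncomputable section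

/-- Real-valued functions on `ℝ^d`. -/
abbrev Rfn (d : ℕ) := (Fin d → ℝ) → ℝ

/-- The partial derivative `∂/∂x^i`. -/
def pderi {d : ℕ} (i : Fin d) (f : Rfn d) : Rfn d := fun x => fderiv ℝ f x (Pi.single i 1)

/-- Iterated partial derivative `∂^α`, indexed by a list of coordinate directions. -/
def pderL {d : ℕ} (L : List (Fin d)) (f : Rfn d) : Rfn d := L.foldr pderi f

/-- `B` is a bidifferential operator on `U` of order at most `N` in each argument:
a finite sum `(f,g) ↦ Σ_{α,β} a^{αβ}·∂^α f·∂^β g` with smooth coefficients. -/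
def IsBidiffOpOn {d : ℕ} (U : Set (Fin d → ℝ)) (N : ℕ) (B : Rfn d → Rfn d → Rfn d) : Prop :=
  ∃ (s : Finset (List (Fin d) × List (Fin d))) (a : List (Fin d) × List (Fin d) → Rfn d),
    (∀ p ∈ s, p.1.length ≤ N ∧ p.2.length ≤ N) ∧
    (∀ p, ContDiffOn ℝ (⊤ : ℕ∞) (a p) U) ∧
    (∀ f g : Rfn d, ∀ x ∈ U, B f g x = ∑ p ∈ s, a p x * pderL p.1 f x * pderL p.2 g x)

/-- The bracket `{f,g} = Σ_{i,j} π^{ij}·∂_i f·∂_j g` of a bivector field `π`. -/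
def pbr {d : ℕ} (π : Fin d → Fin d → Rfn d) (f g : Rfn d) : Rfn d :=
  fun x => ∑ i, ∑ j, π i j x * pderi i f x * pderi j g x

/-- `π₀` is a smooth Poisson bivector field on `U`. -/
def IsPoissonOn {d : ℕ} (U : Set (Fin d → ℝ)) (π₀ : Fin d → Fin d → Rfn d) : Prop :=
  (∀ i j, ContDiffOn ℝ (⊤ : ℕ∞) (π₀ i j) U) ∧
  (∀ i j, ∀ x ∈ U, π₀ i j x = -π₀ j i x) ∧
  (∀ f g h : Rfn d, ContDiffOn ℝ (⊤ : ℕ∞) f U → ContDiffOn ℝ (⊤ : ℕ∞) g U → ContDiffOn ℝ (⊤ : ℕ∞) h U →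
    ∀ x ∈ U, pbr π₀ (pbr π₀ f g) h x + pbr π₀ (pbr π₀ g h) f x + pbr π₀ (pbr π₀ h f) g x = 0)

/-- A natural differential star product `f∗g = Σ_r ν^r·C_r(f,g)` on `(U, π₀)`:
`C₀(f,g) = fg`, `C₁(f,g) − C₁(g,f) = {f,g}₀`, `1` is a unit, the product is associative
(order by order in `ν`), and `C_r` is a bidifferential operator of order at most `r` in
each argument. -/
structure NatStar (d : ℕ) (U : Set (Fin d → ℝ)) (π₀ : Fin d → Fin d → Rfn d) where
  C : ℕ → Rfn d → Rfn d → Rfn d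
  natural : ∀ r, IsBidiffOpOn U r (C r)
  C_zero : ∀ f g : Rfn d, ∀ x ∈ U, C 0 f g x = f x * g x
  C_one_skew : ∀ f g : Rfn d, ContDiffOn ℝ (⊤ : ℕ∞) f U → ContDiffOn ℝ (⊤ : ℕ∞) g U →
    ∀ x ∈ U, C 1 f g x - C 1 g f x = pbr π₀ f g x
  one_left : ∀ r, 0 < r → ∀ f : Rfn d, ContDiffOn ℝ (⊤ : ℕ∞) f U →
    ∀ x ∈ U, C r (fun _ => 1) f x = 0
  one_right : ∀ r, 0 < r → ∀ f : Rfn d, ContDiffOn ℝ (⊤ : ℕ∞) f U →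
    ∀ x ∈ U, C r f (fun _ => 1) x = 0
  assoc : ∀ (r : ℕ) (f g h : Rfn d),
    ContDiffOn ℝ (⊤ : ℕ∞) f U → ContDiffOn ℝ (⊤ : ℕ∞) g U → ContDiffOn ℝ (⊤ : ℕ∞) h U → ∀ x ∈ U,
    ∑ i ∈ Finset.range (r + 1), C i (C (r - i) f g) h x
      = ∑ i ∈ Finset.range (r + 1), C i f (C (r - i) g h) x

/-- The principal symbol of order `r` of an operator `A` of order at most `r`, as a
function on `T*U = U × ℝ^d`:
`σ_r(A)(x,ξ) = (1/r!)·A((y ↦ ⟨y − x, ξ⟩^r))(x)`. -/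
def symb {d : ℕ} (r : ℕ) (A : Rfn d → Rfn d) : ((Fin d → ℝ) × (Fin d → ℝ)) → ℝ :=
  fun p => (r.factorial : ℝ)⁻¹ * A (fun y => (∑ i, p.2 i * (y i - p.1 i)) ^ r) p.1

end

/-- The bidifferential operator `{f,g}₁ := (C₂(f,g) − C₂(g,f)) − (C̃₂(f,g) − C̃₂(g,f))`. -/
def brOne {d : ℕ} {U : Set (Fin d → ℝ)} {π₀ : Fin d → Fin d → Rfn d}
    (SP SP' : NatStar d U π₀) (f g : Rfn d) : Rfn d :=
  fun x => (SP.C 2 f g x - SP.C 2 g f x) - (SP'.C 2 f g x - SP'.C 2 g f x)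

section Derivatives

variable {d : ℕ} {U : Set (Fin d → ℝ)} {f g : Rfn d} {x : Fin d → ℝ}

lemma pderi_congr (i : Fin d) (hfg : f =ᶠ[nhds x] g) : pderi i f =ᶠ[nhds x] pderi i g := by
  filter_upwards [hfg.fderiv (𝕜 := ℝ)] with y hy
  simp [pderi, hy]

lemma pderL_congr (L : List (Fin d)) (hfg : f =ᶠ[nhds x] g) :
    pderL L f =ᶠ[nhds x] pderL L g := by
  induction L with
  | nil => exact hfg
  | cons i L ih => exact pderi_congr i ih

lemma pderL_eqOn (hU : IsOpen U) (L : List (Fin d)) (hfg : ∀ y ∈ U, f y = g y) (hx : x ∈ U) :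
    pderL L f x = pderL L g x :=
  (pderL_congr L (Filter.eventually_of_mem (hU.mem_nhds hx) hfg)).eq_of_nhds

lemma pderi_eqOn (hU : IsOpen U) (i : Fin d) (hfg : ∀ y ∈ U, f y = g y) (hx : x ∈ U) :
    pderi i f x = pderi i g x :=
  pderL_eqOn hU [i] hfg hx

lemma contDiffOn_pderi (hU : IsOpen U) (i : Fin d) (hf : ContDiffOn ℝ (⊤ : ℕ∞) f U) :
    ContDiffOn ℝ (⊤ : ℕ∞) (pderi i f) U :=
  (hf.fderiv_of_isOpen hU (by simp)).clm_apply contDiffOn_const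

lemma contDiffOn_pderL (hU : IsOpen U) (L : List (Fin d)) (hf : ContDiffOn ℝ (⊤ : ℕ∞) f U) :
    ContDiffOn ℝ (⊤ : ℕ∞) (pderL L f) U := by
  induction L with
  | nil => exact hf
  | cons i L ih => exact contDiffOn_pderi hU i ih

lemma ContDiffOn.differentiableAt_of_isOpen (hU : IsOpen U) (hf : ContDiffOn ℝ (⊤ : ℕ∞) f U)
    (hx : x ∈ U) : DifferentiableAt ℝ f x :=
  (hf.contDiffAt (hU.mem_nhds hx)).differentiableAt (by simp)

lemma pderi_add (i : Fin d) (hf : DifferentiableAt ℝ f x) (hg : DifferentiableAt ℝ g x) :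
    pderi i (fun y => f y + g y) x = pderi i f x + pderi i g x := by
  simp [pderi, fderiv_fun_add hf hg]

lemma pderi_sub (i : Fin d) (hf : DifferentiableAt ℝ f x) (hg : DifferentiableAt ℝ g x) :
    pderi i (fun y => f y - g y) x = pderi i f x - pderi i g x := by
  simp [pderi, fderiv_fun_sub hf hg]

lemma pderi_const_mul (i : Fin d) (c : ℝ) (hf : DifferentiableAt ℝ f x) :
    pderi i (fun y => c * f y) x = c * pderi i f x := by
  simp [pderi, fderiv_const_mul hf]

lemma pderi_mul (i : Fin d) (hf : DifferentiableAt ℝ f x) (hg : DifferentiableAt ℝ g x) :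
    pderi i (fun y => f y * g y) x = pderi i f x * g x + f x * pderi i g x := by
  simp [pderi, fderiv_fun_mul hf hg]
  ring

lemma pderi_sum {ι : Type*} (s : Finset ι) (F : ι → Rfn d) (i : Fin d)
    (hF : ∀ k ∈ s, DifferentiableAt ℝ (F k) x) :
    pderi i (fun y => ∑ k ∈ s, F k y) x = ∑ k ∈ s, pderi i (F k) x := by
  simp [pderi, fderiv_fun_sum hF]

lemma pderi_const (i : Fin d) (c : ℝ) : pderi i (fun _ => c) x = 0 := by
  simp [pderi]

lemma pderi_coord_sub (i k : Fin d) (c : ℝ) :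
    pderi i (fun y => y k - c) x = if k = i then 1 else 0 := by
  have h : HasFDerivAt (fun y : Fin d → ℝ => y k - c)
      (ContinuousLinearMap.proj (R := ℝ) (φ := fun _ : Fin d => ℝ) k) x :=
    (hasFDerivAt_apply k x).sub_const c
  simp [pderi, h.fderiv, Pi.single_apply]

lemma pderi_comm (hU : IsOpen U) (hf : ContDiffOn ℝ (⊤ : ℕ∞) f U) (hx : x ∈ U) (i j : Fin d) :
    pderi i (pderi j f) x = pderi j (pderi i f) x := by
  have hd : DifferentiableAt ℝ (fderiv ℝ f) x :=
    ((hf.fderiv_of_isOpen hU (m := 1)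
      (WithTop.coe_le_coe.2 (le_top : (1 + 1 : ℕ∞) ≤ ⊤))).contDiffAt
      (hU.mem_nhds hx)).differentiableAt (by simp)
  have hs : IsSymmSndFDerivAt ℝ f x :=
    (hf.contDiffAt (hU.mem_nhds hx)).isSymmSndFDerivAt (by
      rw [minSmoothness_of_isRCLikeNormedField]
      exact WithTop.coe_le_coe.2 (le_top : (2 : ℕ∞) ≤ ⊤))
  have key : ∀ k l : Fin d, pderi k (pderi l f) x
      = fderiv ℝ (fderiv ℝ f) x (Pi.single k 1) (Pi.single l 1) := fun k l => by
    unfold pderi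
    rw [fderiv_clm_apply hd (differentiableAt_const _)]
    simp
  rw [key, key, hs.eq]

lemma pderL_add (hU : IsOpen U) (L : List (Fin d)) (hf : ContDiffOn ℝ (⊤ : ℕ∞) f U)
    (hg : ContDiffOn ℝ (⊤ : ℕ∞) g U) (hx : x ∈ U) :
    pderL L (fun y => f y + g y) x = pderL L f x + pderL L g x := by
  induction L generalizing x with
  | nil => rfl
  | cons i L ih =>
    exact (pderi_eqOn hU i (fun y hy => ih hy) hx).trans
      (pderi_add i ((contDiffOn_pderL hU L hf).differentiableAt_of_isOpen hU hx)
        ((contDiffOn_pderL hU L hg).differentiableAt_of_isOpen hU hx))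

lemma pderL_const_mul (hU : IsOpen U) (L : List (Fin d)) (c : ℝ)
    (hf : ContDiffOn ℝ (⊤ : ℕ∞) f U) (hx : x ∈ U) :
    pderL L (fun y => c * f y) x = c * pderL L f x := by
  induction L generalizing x with
  | nil => rfl
  | cons i L ih =>
    exact (pderi_eqOn hU i (fun y hy => ih hy) hx).trans
      (pderi_const_mul i c ((contDiffOn_pderL hU L hf).differentiableAt_of_isOpen hU hx))

end Derivatives

section Bidifferential

variable {d : ℕ} {U : Set (Fin d → ℝ)} {N : ℕ} {B : Rfn d → Rfn d → Rfn d}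
  {f f' g g' : Rfn d} {x : Fin d → ℝ}

lemma IsBidiffOpOn.congr_jet (hB : IsBidiffOpOn U N B) (hx : x ∈ U)
    (hf : ∀ L : List (Fin d), L.length ≤ N → pderL L f x = pderL L f' x)
    (hg : ∀ L : List (Fin d), L.length ≤ N → pderL L g x = pderL L g' x) :
    B f g x = B f' g' x := by
  obtain ⟨s, a, hs, -, hB⟩ := hB
  rw [hB _ _ x hx, hB _ _ x hx]
  exact Finset.sum_congr rfl fun p hp => by rw [hf _ (hs p hp).1, hg _ (hs p hp).2]

lemma IsBidiffOpOn.congr (hB : IsBidiffOpOn U N B) (hU : IsOpen U) (hx : x ∈ U)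
    (hf : ∀ y ∈ U, f y = f' y) (hg : ∀ y ∈ U, g y = g' y) : B f g x = B f' g' x :=
  hB.congr_jet hx (fun L _ => pderL_eqOn hU L hf hx) (fun L _ => pderL_eqOn hU L hg hx)

lemma IsBidiffOpOn.contDiffOn (hB : IsBidiffOpOn U N B) (hU : IsOpen U)
    (hf : ContDiffOn ℝ (⊤ : ℕ∞) f U) (hg : ContDiffOn ℝ (⊤ : ℕ∞) g U) :
    ContDiffOn ℝ (⊤ : ℕ∞) (B f g) U := by
  obtain ⟨s, a, -, ha, hB⟩ := hB
  refine ContDiffOn.congr ?_ (hB f g)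
  exact ContDiffOn.sum fun p _ =>
    ((ha p).mul (contDiffOn_pderL hU _ hf)).mul (contDiffOn_pderL hU _ hg)

lemma IsBidiffOpOn.add_left (hB : IsBidiffOpOn U N B) (hU : IsOpen U)
    (hf : ContDiffOn ℝ (⊤ : ℕ∞) f U) (hf' : ContDiffOn ℝ (⊤ : ℕ∞) f' U) (hx : x ∈ U) :
    B (fun y => f y + f' y) g x = B f g x + B f' g x := by
  obtain ⟨s, a, -, -, hB⟩ := hB
  simp only [hB _ _ x hx, pderL_add hU _ hf hf' hx, ← Finset.sum_add_distrib]
  exact Finset.sum_congr rfl fun p _ => by ring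

lemma IsBidiffOpOn.const_mul_left (hB : IsBidiffOpOn U N B) (hU : IsOpen U) (c : ℝ)
    (hf : ContDiffOn ℝ (⊤ : ℕ∞) f U) (hx : x ∈ U) :
    B (fun y => c * f y) g x = c * B f g x := by
  obtain ⟨s, a, -, -, hB⟩ := hB
  simp only [hB _ _ x hx, pderL_const_mul hU _ c hf hx, Finset.mul_sum]
  exact Finset.sum_congr rfl fun p _ => by ring

lemma IsBidiffOpOn.flip (hB : IsBidiffOpOn U N B) : IsBidiffOpOn U N (fun f g => B g f) := by
  classical
  obtain ⟨s, a, hs, ha, hB⟩ := hB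
  refine ⟨s.map (Equiv.prodComm _ _).toEmbedding, fun p => a p.swap, ?_, fun p => ha _, ?_⟩
  · intro p hp
    obtain ⟨q, hq, rfl⟩ := Finset.mem_map.1 hp
    exact (hs q hq).symm
  · intro f g x hx
    rw [Finset.sum_map]
    refine (hB g f x hx).trans ?_
    exact Finset.sum_congr rfl fun p _ => by simp; ring

lemma IsBidiffOpOn.sub_left (hB : IsBidiffOpOn U N B) (hU : IsOpen U)
    (hf : ContDiffOn ℝ (⊤ : ℕ∞) f U) (hf' : ContDiffOn ℝ (⊤ : ℕ∞) f' U) (hx : x ∈ U) :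
    B (fun y => f y - f' y) g x = B f g x - B f' g x := by
  have h := hB.add_left (g := g) hU hf (contDiffOn_const (c := (-1 : ℝ)) |>.mul hf') hx
  rw [hB.const_mul_left hU (-1) hf' hx] at h
  rw [sub_eq_add_neg, ← neg_one_mul, ← h]
  exact hB.congr hU hx (fun y _ => by ring) (fun _ _ => rfl)

lemma IsBidiffOpOn.sub_right (hB : IsBidiffOpOn U N B) (hU : IsOpen U)
    (hg : ContDiffOn ℝ (⊤ : ℕ∞) g U) (hg' : ContDiffOn ℝ (⊤ : ℕ∞) g' U) (hx : x ∈ U) :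
    B f (fun y => g y - g' y) x = B f g x - B f g' x :=
  hB.flip.sub_left hU hg hg' hx

end Bidifferential

/-- A linear functional on smooth functions which is a derivation at `x` and only depends on the
2-jet at `x` is a tangent vector at `x`. -/
lemma derivation_eq_sum_pderi {d : ℕ} {U : Set (Fin d → ℝ)} (hU : IsOpen U) {x : Fin d → ℝ}
    (hx : x ∈ U) (D : Rfn d → ℝ)
    (hadd : ∀ f g : Rfn d, ContDiffOn ℝ (⊤ : ℕ∞) f U → ContDiffOn ℝ (⊤ : ℕ∞) g U →
      D (fun y => f y + g y) = D f + D g)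
    (hsmul : ∀ (c : ℝ) (f : Rfn d), ContDiffOn ℝ (⊤ : ℕ∞) f U → D (fun y => c * f y) = c * D f)
    (hmul : ∀ f g : Rfn d, ContDiffOn ℝ (⊤ : ℕ∞) f U → ContDiffOn ℝ (⊤ : ℕ∞) g U →
      D (fun y => f y * g y) = f x * D g + D f * g x)
    (hjet : ∀ f g : Rfn d, (∀ L : List (Fin d), L.length ≤ 2 → pderL L f x = pderL L g x) →
      D f = D g)
    {f : Rfn d} (hf : ContDiffOn ℝ (⊤ : ℕ∞) f U) :
    D f = ∑ i, pderi i f x * D (fun y => y i) := by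
  have hone : D (fun _ => 1) = 0 := by
    have h := hmul (fun _ => 1) (fun _ => 1) contDiffOn_const contDiffOn_const
    norm_num at h
    exact h
  have hconst : ∀ c : ℝ, D (fun _ => c) = 0 := fun c => by
    have h := hsmul c (fun _ => 1) contDiffOn_const
    simpa [hone] using h
  have hsum : ∀ {ι : Type} (s : Finset ι) (F : ι → Rfn d),
      (∀ k, ContDiffOn ℝ (⊤ : ℕ∞) (F k) U) →
      D (fun y => ∑ k ∈ s, F k y) = ∑ k ∈ s, D (F k) := by
    classical
    intro ι s F hF
    induction s using Finset.induction_on with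
    | empty => simpa using hconst 0
    | insert k s hk ih =>
      simp only [Finset.sum_insert hk]
      rw [hadd _ _ (hF k) (ContDiffOn.sum fun l _ => hF l), ih]
  have hcoord : ∀ i : Fin d, ContDiffOn ℝ (⊤ : ℕ∞) (fun y : Fin d → ℝ => y i) U :=
    fun i => (contDiff_apply ℝ ℝ i).contDiffOn
  have hq : ∀ i : Fin d, ContDiffOn ℝ (⊤ : ℕ∞) (fun y : Fin d → ℝ => y i - x i) U :=
    fun i => (hcoord i).sub contDiffOn_const
  have hqd : ∀ (i : Fin d) (y : Fin d → ℝ),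
      DifferentiableAt ℝ (fun y : Fin d → ℝ => y i - x i) y := fun i y => by fun_prop
  have hDq : ∀ i, D (fun y => y i - x i) = D (fun y => y i) := fun i => by
    have h := hadd (fun y => y i) (fun _ => -x i) (hcoord i) contDiffOn_const
    simpa [hconst, sub_eq_add_neg] using h
  have hDqq : ∀ i j, D (fun y => (y i - x i) * (y j - x j)) = 0 := fun i j => by
    rw [hmul _ _ (hq i) (hq j)]
    simp
  set a : Fin d → ℝ := fun i => pderi i f x with ha
  set b : Fin d → Fin d → ℝ := fun i j => 2⁻¹ * pderi i (pderi j f) x with hb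
  set l : Rfn d := fun y => ∑ i, a i * (y i - x i) with hl
  set q : Rfn d := fun y => ∑ i, ∑ j, b i j * ((y i - x i) * (y j - x j)) with hqdef
  have hlS : ContDiffOn ℝ (⊤ : ℕ∞) l U :=
    ContDiffOn.sum fun i _ => contDiffOn_const.mul (hq i)
  have hqS : ContDiffOn ℝ (⊤ : ℕ∞) q U :=
    ContDiffOn.sum fun i _ => ContDiffOn.sum fun j _ =>
      contDiffOn_const.mul ((hq i).mul (hq j))
  have hld : ∀ y, DifferentiableAt ℝ l y := fun y => by
    rw [hl]
    fun_prop
  have hqqd : ∀ y, DifferentiableAt ℝ q y := fun y => by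
    rw [hqdef]
    fun_prop
  have hDl : D l = ∑ i, a i * D (fun y => y i) := by
    rw [hl, hsum _ _ fun i => contDiffOn_const.mul (hq i)]
    exact Finset.sum_congr rfl fun i _ => by rw [hsmul _ _ (hq i), hDq]
  have hDqz : D q = 0 := by
    rw [hqdef, hsum _ _ fun i => ContDiffOn.sum fun j _ =>
      contDiffOn_const.mul ((hq i).mul (hq j))]
    refine Finset.sum_eq_zero fun i _ => ?_
    rw [hsum _ _ fun j => contDiffOn_const.mul ((hq i).mul (hq j))]
    exact Finset.sum_eq_zero fun j _ => by
      rw [hsmul _ _ ((hq i).mul (hq j)), hDqq, mul_zero]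
  have hpl : ∀ k y, pderi k l y = a k := fun k y => by
    rw [hl, pderi_sum _ _ _ fun i _ => (hqd i y).const_mul _]
    simp [pderi_const_mul _ _ (hqd _ y), pderi_coord_sub]
  have hbsymm : ∀ i j, b i j = b j i := fun i j => by
    simp only [hb, pderi_comm hU hf hx i j]
  have hpq : ∀ k y, pderi k q y = ∑ j, (2 * b k j) * (y j - x j) := fun k y => by
    rw [hqdef, pderi_sum _ _ _ fun i _ => by fun_prop]
    have h1 : ∀ i, pderi k (fun y => ∑ j, b i j * ((y i - x i) * (y j - x j))) y
        = ∑ j, b i j * ((if i = k then 1 else 0) * (y j - x j)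
          + (y i - x i) * (if j = k then 1 else 0)) := fun i => by
      rw [pderi_sum _ _ _ fun j _ => by fun_prop]
      refine Finset.sum_congr rfl fun j _ => ?_
      rw [pderi_const_mul _ _ (by fun_prop), pderi_mul _ (hqd i y) (hqd j y),
        pderi_coord_sub, pderi_coord_sub]
    simp only [h1, mul_add, Finset.sum_add_distrib]
    rw [Finset.sum_comm]
    simp only [ite_mul, mul_ite, one_mul, zero_mul, mul_one, mul_zero, Finset.sum_ite_eq',
      Finset.mem_univ, if_true, two_mul, add_mul, Finset.sum_add_distrib]
    exact congrArg _ (Finset.sum_congr rfl fun i _ => by rw [hbsymm])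
  have hp : ∀ k y, pderi k (fun y => f x + (l y + q y)) y
      = a k + ∑ j, (2 * b k j) * (y j - x j) := fun k y => by
    rw [pderi_add _ (by fun_prop) ((hld y).fun_add (hqqd y)), pderi_add _ (hld y) (hqqd y),
      pderi_const, hpl, hpq, zero_add]
  have hDf : D f = D (fun y => f x + (l y + q y)) := by
    refine hjet _ _ fun L hL => ?_
    match L, hL with
    | [], _ => simp [pderL, hl, hqdef]
    | [k], _ => simp [pderL, hp, ha]
    | [m, k], _ =>
      have h1 : pderi k (fun y => f x + (l y + q y))
          = fun y => a k + ∑ j, (2 * b k j) * (y j - x j) := funext (hp k)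
      simp only [pderL, List.foldr, h1]
      rw [pderi_add _ (by fun_prop) (by fun_prop), pderi_const,
        pderi_sum _ _ _ fun i _ => by fun_prop]
      simp only [pderi_const_mul _ _ (hqd _ x), pderi_coord_sub]
      simp [hb, pderi_comm hU hf hx m k]
  rw [hDf, hadd _ _ contDiffOn_const (hlS.add hqS), hadd _ _ hlS hqS, hconst, hDl, hDqz]
  simp [ha]

section StarProduct

variable {d : ℕ} {U : Set (Fin d → ℝ)} {π₀ : Fin d → Fin d → Rfn d}

namespace NatStar

variable (SP : NatStar d U π₀) {f g h : Rfn d} {x : Fin d → ℝ}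

lemma contDiffOn_C (hU : IsOpen U) (r : ℕ) (hf : ContDiffOn ℝ (⊤ : ℕ∞) f U)
    (hg : ContDiffOn ℝ (⊤ : ℕ∞) g U) : ContDiffOn ℝ (⊤ : ℕ∞) (SP.C r f g) U :=
  (SP.natural r).contDiffOn hU hf hg

/-- The `ν^r`-coefficient of the star commutator. -/
def comm (r : ℕ) (f g : Rfn d) : Rfn d := fun x => SP.C r f g x - SP.C r g f x

lemma contDiffOn_comm (hU : IsOpen U) (r : ℕ) (hf : ContDiffOn ℝ (⊤ : ℕ∞) f U)
    (hg : ContDiffOn ℝ (⊤ : ℕ∞) g U) : ContDiffOn ℝ (⊤ : ℕ∞) (SP.comm r f g) U :=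
  (SP.contDiffOn_C hU r hf hg).sub (SP.contDiffOn_C hU r hg hf)

lemma comm_comm (hU : IsOpen U) (i j : ℕ) (hf : ContDiffOn ℝ (⊤ : ℕ∞) f U)
    (hg : ContDiffOn ℝ (⊤ : ℕ∞) g U) (hx : x ∈ U) :
    SP.comm i (SP.comm j f g) h x
      = SP.C i (SP.C j f g) h x - SP.C i (SP.C j g f) h x
        - (SP.C i h (SP.C j f g) x - SP.C i h (SP.C j g f) x) := by
  rw [← (SP.natural i).sub_left hU (SP.contDiffOn_C hU j hf hg) (SP.contDiffOn_C hU j hg hf) hx,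
    ← (SP.natural i).sub_right hU (SP.contDiffOn_C hU j hf hg) (SP.contDiffOn_C hU j hg hf) hx]
  rfl

/-- The `ν^r`-coefficient of the Jacobi identity of the star commutator. -/
lemma jacobi (hU : IsOpen U) (r : ℕ) (hf : ContDiffOn ℝ (⊤ : ℕ∞) f U)
    (hg : ContDiffOn ℝ (⊤ : ℕ∞) g U) (hh : ContDiffOn ℝ (⊤ : ℕ∞) h U) (hx : x ∈ U) :
    ∑ i ∈ Finset.range (r + 1), (SP.comm i (SP.comm (r - i) f g) h x
      + SP.comm i (SP.comm (r - i) g h) f x + SP.comm i (SP.comm (r - i) h f) g x) = 0 := by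
  simp only [SP.comm_comm hU _ _ hf hg hx, SP.comm_comm hU _ _ hg hh hx,
    SP.comm_comm hU _ _ hh hf hx, Finset.sum_add_distrib, Finset.sum_sub_distrib]
  linarith [SP.assoc r f g h hf hg hh x hx, SP.assoc r g h f hg hh hf x hx,
    SP.assoc r h f g hh hf hg x hx, SP.assoc r g f h hg hf hh x hx,
    SP.assoc r h g f hh hg hf x hx, SP.assoc r f h g hf hh hg x hx]

lemma comm_congr_left (hU : IsOpen U) (r : ℕ) {f' : Rfn d} (hf : ∀ y ∈ U, f y = f' y)
    (hx : x ∈ U) : SP.comm r f g x = SP.comm r f' g x := by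
  unfold comm
  rw [(SP.natural r).congr hU hx hf (fun _ _ => rfl),
    (SP.natural r).congr hU hx (fun _ _ => rfl) hf]

lemma comm_zero (hx : x ∈ U) : SP.comm 0 f g x = 0 := by
  simp [comm, SP.C_zero _ _ x hx, mul_comm]

lemma comm_zero_fun_left (hU : IsOpen U) (r : ℕ)
    (hf : ∀ y ∈ U, f y = 0) (hx : x ∈ U) : SP.comm r f g x = 0 := by
  have h1 := (SP.natural r).const_mul_left (g := g) hU 0 (contDiffOn_const (c := (0 : ℝ))) hx
  have h2 := (SP.natural r).flip.const_mul_left (g := g) hU 0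
    (contDiffOn_const (c := (0 : ℝ))) hx
  rw [SP.comm_congr_left hU r (f' := fun _ => 0) hf hx]
  simp only [zero_mul] at h1 h2
  simp [comm, h1, h2]

/-- The third order Jacobi identity only involves the first two commutator coefficients. -/
lemma jacobi_three (hU : IsOpen U) (hf : ContDiffOn ℝ (⊤ : ℕ∞) f U)
    (hg : ContDiffOn ℝ (⊤ : ℕ∞) g U) (hh : ContDiffOn ℝ (⊤ : ℕ∞) h U) (hx : x ∈ U) :
    SP.comm 2 (pbr π₀ f g) h x + SP.comm 2 (pbr π₀ g h) f x + SP.comm 2 (pbr π₀ h f) g x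
      + pbr π₀ (SP.comm 2 f g) h x + pbr π₀ (SP.comm 2 g h) f x
      + pbr π₀ (SP.comm 2 h f) g x = 0 := by
  have key := SP.jacobi hU 3 hf hg hh hx
  have hz : ∀ u v w : Rfn d, SP.comm 3 (SP.comm 0 u v) w x = 0 := fun u v w =>
    SP.comm_zero_fun_left hU 3 (fun y hy => SP.comm_zero hy) hx
  have htwo : ∀ u v w : Rfn d, ContDiffOn ℝ (⊤ : ℕ∞) u U → ContDiffOn ℝ (⊤ : ℕ∞) v U →
      SP.comm 2 (SP.comm 1 u v) w x = SP.comm 2 (pbr π₀ u v) w x := fun u v w hu hv =>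
    SP.comm_congr_left hU 2 (fun y hy => SP.C_one_skew u v hu hv y hy) hx
  have hone : ∀ u v w : Rfn d, ContDiffOn ℝ (⊤ : ℕ∞) u U → ContDiffOn ℝ (⊤ : ℕ∞) v U →
      ContDiffOn ℝ (⊤ : ℕ∞) w U →
      SP.comm 1 (SP.comm 2 u v) w x = pbr π₀ (SP.comm 2 u v) w x := fun u v w hu hv hw =>
    SP.C_one_skew _ _ (SP.contDiffOn_comm hU 2 hu hv) hw x hx
  simp only [Finset.sum_range_succ, Finset.sum_range_zero, Nat.sub_zero, Nat.sub_self,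
    show 3 - 1 = 2 from rfl, show 3 - 2 = 1 from rfl, SP.comm_zero hx] at key
  rw [hz f g h, hz g h f, hz h f g, htwo f g h hf hg, htwo g h f hg hh,
    htwo h f g hh hf, hone f g h hf hg hh, hone g h f hg hh hf, hone h f g hh hf hg] at key
  linarith

end NatStar

lemma pbr_sub_left (hU : IsOpen U) {u v w : Rfn d} {x : Fin d → ℝ}
    (hu : ContDiffOn ℝ (⊤ : ℕ∞) u U) (hv : ContDiffOn ℝ (⊤ : ℕ∞) v U) (hx : x ∈ U) :
    pbr π₀ (fun y => u y - v y) w x = pbr π₀ u w x - pbr π₀ v w x := by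
  simp only [pbr, ← Finset.sum_sub_distrib]
  refine Finset.sum_congr rfl fun i _ => Finset.sum_congr rfl fun j _ => ?_
  rw [pderi_sub i (hu.differentiableAt_of_isOpen hU hx) (hv.differentiableAt_of_isOpen hU hx)]
  ring

variable (SP SP' : NatStar d U π₀)

lemma brOne_skew (f g : Rfn d) (x : Fin d → ℝ) : brOne SP SP' f g x = -brOne SP SP' g f x := by
  unfold brOne
  ring

/-- `C₂ − C̃₂` is a Hochschild 2-cocycle when `C₁ = C̃₁`. -/
lemma hochschild_cocycle (hU : IsOpen U)
    (hC1 : ∀ f g : Rfn d, ContDiffOn ℝ (⊤ : ℕ∞) f U → ContDiffOn ℝ (⊤ : ℕ∞) g U →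
      ∀ x ∈ U, SP.C 1 f g x = SP'.C 1 f g x)
    {f g h : Rfn d} (hf : ContDiffOn ℝ (⊤ : ℕ∞) f U) (hg : ContDiffOn ℝ (⊤ : ℕ∞) g U)
    (hh : ContDiffOn ℝ (⊤ : ℕ∞) h U) {x : Fin d → ℝ} (hx : x ∈ U) :
    (SP.C 2 f g x - SP'.C 2 f g x) * h x
      + (SP.C 2 (fun y => f y * g y) h x - SP'.C 2 (fun y => f y * g y) h x)
      = f x * (SP.C 2 g h x - SP'.C 2 g h x)
        + (SP.C 2 f (fun y => g y * h y) x - SP'.C 2 f (fun y => g y * h y) x) := by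
  have expand : ∀ S : NatStar d U π₀,
      S.C 2 f g x * h x + S.C 1 (S.C 1 f g) h x + S.C 2 (fun y => f y * g y) h x
        = f x * S.C 2 g h x + S.C 1 f (S.C 1 g h) x + S.C 2 f (fun y => g y * h y) x := by
    intro S
    have key := S.assoc 2 f g h hf hg hh x hx
    simp only [Finset.sum_range_succ, Finset.sum_range_zero, Nat.sub_zero, Nat.sub_self,
      show 2 - 1 = 1 from rfl, S.C_zero _ _ x hx, zero_add] at key
    rwa [(S.natural 2).congr hU hx (fun y hy => S.C_zero f g y hy) (fun _ _ => rfl),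
      (S.natural 2).congr hU hx (fun _ _ => rfl) (fun y hy => S.C_zero g h y hy)] at key
  have hl : SP.C 1 (SP.C 1 f g) h x = SP'.C 1 (SP'.C 1 f g) h x := by
    rw [hC1 _ _ (SP.contDiffOn_C hU 1 hf hg) hh x hx]
    exact (SP'.natural 1).congr hU hx (hC1 f g hf hg) (fun _ _ => rfl)
  have hr : SP.C 1 f (SP.C 1 g h) x = SP'.C 1 f (SP'.C 1 g h) x := by
    rw [hC1 _ _ hf (SP.contDiffOn_C hU 1 hg hh) x hx]
    exact (SP'.natural 1).congr hU hx (fun _ _ => rfl) (hC1 g h hg hh)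
  linarith [expand SP, expand SP']

lemma brOne_mul_left (hU : IsOpen U)
    (hC1 : ∀ f g : Rfn d, ContDiffOn ℝ (⊤ : ℕ∞) f U → ContDiffOn ℝ (⊤ : ℕ∞) g U →
      ∀ x ∈ U, SP.C 1 f g x = SP'.C 1 f g x)
    {f g h : Rfn d} (hf : ContDiffOn ℝ (⊤ : ℕ∞) f U) (hg : ContDiffOn ℝ (⊤ : ℕ∞) g U)
    (hh : ContDiffOn ℝ (⊤ : ℕ∞) h U) {x : Fin d → ℝ} (hx : x ∈ U) :
    brOne SP SP' (fun y => f y * g y) h x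
      = f x * brOne SP SP' g h x + brOne SP SP' f h x * g x := by
  have h1 := hochschild_cocycle SP SP' hU hC1 hf hg hh hx
  have h2 := hochschild_cocycle SP SP' hU hC1 hf hh hg hx
  have h3 := hochschild_cocycle SP SP' hU hC1 hh hf hg hx
  have e1 : (fun y => h y * g y) = fun y => g y * h y := funext fun y => mul_comm _ _
  have e2 : (fun y => h y * f y) = fun y => f y * h y := funext fun y => mul_comm _ _
  rw [e1] at h2
  rw [e2] at h3
  unfold brOne
  linear_combination h1 - h2 + h3

lemma contDiffOn_brOne (hU : IsOpen U) {f g : Rfn d} (hf : ContDiffOn ℝ (⊤ : ℕ∞) f U)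
    (hg : ContDiffOn ℝ (⊤ : ℕ∞) g U) : ContDiffOn ℝ (⊤ : ℕ∞) (brOne SP SP' f g) U :=
  (SP.contDiffOn_comm hU 2 hf hg).sub (SP'.contDiffOn_comm hU 2 hf hg)

lemma brOne_eq_sum_left (hU : IsOpen U)
    (hC1 : ∀ f g : Rfn d, ContDiffOn ℝ (⊤ : ℕ∞) f U → ContDiffOn ℝ (⊤ : ℕ∞) g U →
      ∀ x ∈ U, SP.C 1 f g x = SP'.C 1 f g x)
    {f g : Rfn d} (hf : ContDiffOn ℝ (⊤ : ℕ∞) f U) (hg : ContDiffOn ℝ (⊤ : ℕ∞) g U)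
    {x : Fin d → ℝ} (hx : x ∈ U) :
    brOne SP SP' f g x = ∑ i, pderi i f x * brOne SP SP' (fun y => y i) g x := by
  refine derivation_eq_sum_pderi hU hx (fun u => brOne SP SP' u g x) ?_ ?_ ?_ ?_ hf
  · intro u v hu hv
    simp only [brOne]
    rw [(SP.natural 2).add_left hU hu hv hx, (SP'.natural 2).add_left hU hu hv hx,
      (SP.natural 2).flip.add_left hU hu hv hx, (SP'.natural 2).flip.add_left hU hu hv hx]
    ring
  · intro c u hu
    simp only [brOne]
    rw [(SP.natural 2).const_mul_left hU c hu hx, (SP'.natural 2).const_mul_left hU c hu hx,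
      (SP.natural 2).flip.const_mul_left hU c hu hx,
      (SP'.natural 2).flip.const_mul_left hU c hu hx]
    ring
  · exact fun u v hu hv => brOne_mul_left SP SP' hU hC1 hu hv hg hx
  · intro u v huv
    simp only [brOne]
    rw [(SP.natural 2).congr_jet hx huv fun _ _ => rfl,
      (SP'.natural 2).congr_jet hx huv fun _ _ => rfl,
      (SP.natural 2).congr_jet hx (fun _ _ => rfl) huv,
      (SP'.natural 2).congr_jet hx (fun _ _ => rfl) huv]

end StarProduct

/-- Let `∗` and `∗̃` be natural differential star products on
`(U, π₀)` with `C₁ = C̃₁`.  Then `{·,·}₁ := (D₂ − D̃₂)` is skew-symmetric and a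
derivation in each argument (hence given by a bivector field `π₁` on `U`), and `π₁` is
a Poisson 2-cocycle with respect to `π₀`:
`{{f,g}₀,h}₁ + {{g,h}₀,f}₁ + {{h,f}₀,g}₁ + {{f,g}₁,h}₀ + {{g,h}₁,f}₀ + {{h,f}₁,g}₀ = 0`. -/
theorem brOne_cocycle {d : ℕ} (U : Set (Fin d → ℝ)) (hU : IsOpen U)
    (π₀ : Fin d → Fin d → Rfn d) (hπ : IsPoissonOn U π₀)
    (SP SP' : NatStar d U π₀)
    (hC1 : ∀ f g : Rfn d, ContDiffOn ℝ (⊤ : ℕ∞) f U → ContDiffOn ℝ (⊤ : ℕ∞) g U →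
      ∀ x ∈ U, SP.C 1 f g x = SP'.C 1 f g x) :
    (∀ f g : Rfn d, ContDiffOn ℝ (⊤ : ℕ∞) f U → ContDiffOn ℝ (⊤ : ℕ∞) g U →
      ∀ x ∈ U, brOne SP SP' f g x = -brOne SP SP' g f x) ∧
    (∀ f g h : Rfn d, ContDiffOn ℝ (⊤ : ℕ∞) f U → ContDiffOn ℝ (⊤ : ℕ∞) g U → ContDiffOn ℝ (⊤ : ℕ∞) h U →
      ∀ x ∈ U,
        brOne SP SP' (fun y => f y * g y) h x
          = f x * brOne SP SP' g h x + brOne SP SP' f h x * g x ∧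
        brOne SP SP' f (fun y => g y * h y) x
          = g x * brOne SP SP' f h x + brOne SP SP' f g x * h x) ∧
    (∃ π₁ : Fin d → Fin d → Rfn d,
      (∀ i j, ContDiffOn ℝ (⊤ : ℕ∞) (π₁ i j) U) ∧
      (∀ f g : Rfn d, ContDiffOn ℝ (⊤ : ℕ∞) f U → ContDiffOn ℝ (⊤ : ℕ∞) g U →
        ∀ x ∈ U, brOne SP SP' f g x = pbr π₁ f g x)) ∧
    (∀ f g h : Rfn d, ContDiffOn ℝ (⊤ : ℕ∞) f U → ContDiffOn ℝ (⊤ : ℕ∞) g U → ContDiffOn ℝ (⊤ : ℕ∞) h U →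
      ∀ x ∈ U,
        brOne SP SP' (pbr π₀ f g) h x + brOne SP SP' (pbr π₀ g h) f x
            + brOne SP SP' (pbr π₀ h f) g x
          + pbr π₀ (brOne SP SP' f g) h x + pbr π₀ (brOne SP SP' g h) f x
            + pbr π₀ (brOne SP SP' h f) g x = 0) := by
  refine ⟨fun f g _ _ x _ => brOne_skew SP SP' f g x, fun f g h hf hg hh x hx => ⟨?_, ?_⟩,
    ⟨fun i j => brOne SP SP' (fun y => y i) (fun y => y j), fun i j => ?_,
      fun f g hf hg x hx => ?_⟩, fun f g h hf hg hh x hx => ?_⟩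
  · exact brOne_mul_left SP SP' hU hC1 hf hg hh hx
  · rw [brOne_skew, brOne_mul_left SP SP' hU hC1 hg hh hf hx, brOne_skew SP SP' f h,
      brOne_skew SP SP' f g]
    ring
  · exact contDiffOn_brOne SP SP' hU (contDiff_apply ℝ ℝ i).contDiffOn
      (contDiff_apply ℝ ℝ j).contDiffOn
  · rw [brOne_eq_sum_left SP SP' hU hC1 hf hg hx]
    refine Finset.sum_congr rfl fun i _ => ?_
    rw [brOne_skew, brOne_eq_sum_left SP SP' hU hC1 hg (contDiff_apply ℝ ℝ i).contDiffOn hx,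
      ← Finset.sum_neg_distrib, Finset.mul_sum]
    refine Finset.sum_congr rfl fun j _ => ?_
    rw [brOne_skew SP SP' (fun y => y j)]
    ring
  · have hsub : ∀ u v w : Rfn d, ContDiffOn ℝ (⊤ : ℕ∞) u U → ContDiffOn ℝ (⊤ : ℕ∞) v U →
        pbr π₀ (brOne SP SP' u v) w x
          = pbr π₀ (SP.comm 2 u v) w x - pbr π₀ (SP'.comm 2 u v) w x := fun u v w hu hv =>
      pbr_sub_left hU (SP.contDiffOn_comm hU 2 hu hv) (SP'.contDiffOn_comm hU 2 hu hv) hx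
    have hbr : ∀ u v : Rfn d, brOne SP SP' u v x = SP.comm 2 u v x - SP'.comm 2 u v x :=
      fun _ _ => rfl
    rw [hsub f g h hf hg, hsub g h f hg hh, hsub h f g hh hf, hbr, hbr, hbr]
    linarith [SP.jacobi_three hU hf hg hh hx, SP'.jacobi_three hU hf hg hh hx]
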